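/- The progression angle satisfies lim_{C₂ → (3·4^{1/3})⁺} Λ^Θ(C₂) = √2·π, where the limit is taken as C₂ decreases to 3·4^{1/3} from the right. -/

import Mathlib

open Filter

/-- The complete elliptic integral of the third kind
`Π(n, m) = ∫₀^{π/2} dθ / ((1 - n sin²θ)·√(1 - m sin²θ))`. -/
noncomputable def ellipticPi (n m : ℝ) : ℝ :=
  ∫ θ in (0 : ℝ)..(Real.pi / 2),
    1 / ((1 - n * Real.sin θ ^ 2) * Real.sqrt (1 - m * Real.sin θ ^ 2))

theorem tendsto_ellipticPi_zero :
    Tendsto (fun p : ℝ × ℝ => ellipticPi p.1 p.2) (nhds (0, 0)) (nhds (Real.pi / 2)) := by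
  have hlim : (∫ _ in (0 : ℝ)..(Real.pi / 2), (1 : ℝ)) = Real.pi / 2 := by simp
  rw [← hlim]
  refine intervalIntegral.tendsto_integral_filter_of_dominated_convergence (fun _ => 4) ?_ ?_ ?_ ?_
  · refine Eventually.of_forall fun p => Measurable.aestronglyMeasurable ?_
    fun_prop
  · have hn : ∀ᶠ p : ℝ × ℝ in nhds (0, 0), p.1 < 1 / 2 :=
      continuous_fst.continuousAt.eventually_lt continuousAt_const (by norm_num)
    have hm : ∀ᶠ p : ℝ × ℝ in nhds (0, 0), p.2 < 1 / 2 :=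
      continuous_snd.continuousAt.eventually_lt continuousAt_const (by norm_num)
    filter_upwards [hn, hm] with p hn hm
    refine Eventually.of_forall fun θ _ => ?_
    have h0 := sq_nonneg (Real.sin θ)
    have h1 := Real.sin_sq_le_one θ
    have hA : 1 / 2 ≤ 1 - p.1 * Real.sin θ ^ 2 := by nlinarith
    have hB : 1 / 2 ≤ Real.sqrt (1 - p.2 * Real.sin θ ^ 2) :=
      Real.le_sqrt_of_sq_le (by nlinarith)
    rw [Real.norm_of_nonneg (by positivity), div_le_iff₀ (by positivity)]
    nlinarith
  · simp
  · refine Eventually.of_forall fun θ _ => ?_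
    have h : ContinuousAt (fun p : ℝ × ℝ =>
        1 / ((1 - p.1 * Real.sin θ ^ 2) * Real.sqrt (1 - p.2 * Real.sin θ ^ 2))) (0, 0) := by
      refine ContinuousAt.div (by fun_prop) (by fun_prop) ?_
      simp
    simpa using h.tendsto

/-- Vieta's relations for the roots of `x³ - Cx + 4`. -/
theorem add_add_eq_zero_and_sq_of_roots {C a b c : ℝ} (hab : a ≠ b) (hbc : b ≠ c) (hac : a ≠ c)
    (ha : a ^ 3 - C * a + 4 = 0) (hb : b ^ 3 - C * b + 4 = 0) (hc : c ^ 3 - C * c + 4 = 0) :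
    a + b + c = 0 ∧ a ^ 2 + a * b + b ^ 2 = C := by
  have h1 : a ^ 2 + a * b + b ^ 2 = C :=
    mul_left_cancel₀ (sub_ne_zero.2 hab) (by linear_combination ha - hb)
  have h2 : a ^ 2 + a * c + c ^ 2 = C :=
    mul_left_cancel₀ (sub_ne_zero.2 hac) (by linear_combination ha - hc)
  exact ⟨mul_left_cancel₀ (sub_ne_zero.2 hbc) (by linear_combination h1 - h2), h1⟩

/-- If `x³ - Cx + 4` has positive roots `b < a`, then near the double-root case `C = 3s²`,
`s³ = 2`, the sum and the difference of these roots are controlled by `C`. -/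
theorem bounds_of_roots {C s a b c : ℝ} (hs : 0 < s) (hs3 : s ^ 3 = 2)
    (hab : b < a) (hb0 : 0 < b) (hc0 : c < 0)
    (ha : a ^ 3 - C * a + 4 = 0) (hb : b ^ 3 - C * b + 4 = 0) (hc : c ^ 3 - C * c + 4 = 0) :
    2 * s ≤ a + b ∧ a + b ≤ 2 * Real.sqrt (C / 3) ∧
      a - b ≤ 2 * Real.sqrt (C - 3 * s ^ 2) ∧ c = -(a + b) := by
  obtain ⟨hsum, hC⟩ := add_add_eq_zero_and_sq_of_roots hab.ne' (hc0.trans hb0).ne'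
    (hc0.trans (hb0.trans hab)).ne' ha hb hc
  have hprod : a * b * (a + b) = 4 := by
    linear_combination a * hC - ha
  have hp : 2 * s ≤ a + b := by
    refine le_of_pow_le_pow_left₀ three_ne_zero (by linarith) ?_
    nlinarith [mul_nonneg (by linarith : 0 ≤ a + b) (sq_nonneg (a - b))]
  refine ⟨hp, ?_, ?_, by linarith⟩
  · have : (a + b) / 2 ≤ Real.sqrt (C / 3) :=
      Real.le_sqrt_of_sq_le (by nlinarith [sq_nonneg (a - b)])
    linarith
  · have : (a - b) / 2 ≤ Real.sqrt (C - 3 * s ^ 2) :=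
      Real.le_sqrt_of_sq_le (by nlinarith)
    linarith

theorem progression_limit_value {s : ℝ} (hs : 0 < s) (hs3 : s ^ 3 = 2) :
    4 / ((s + Real.sqrt 3 * s) * Real.sqrt (3 * s)) * (Real.pi / 2) -
      4 / ((s - Real.sqrt 3 * s) * Real.sqrt (3 * s)) * (Real.pi / 2) =
      Real.sqrt 2 * Real.pi := by
  have h3 : Real.sqrt 3 ^ 2 = 3 := Real.sq_sqrt (by norm_num)
  have h31 : 1 < Real.sqrt 3 := Real.lt_sqrt_of_sq_lt (by norm_num)
  have h2 : Real.sqrt 2 = s * Real.sqrt s := by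
    rw [← hs3, show s ^ 3 = s ^ 2 * s by ring, Real.sqrt_mul (by positivity),
      Real.sqrt_sq hs.le]
  have hss : Real.sqrt s ^ 2 = s := Real.sq_sqrt hs.le
  have hs0 : Real.sqrt s ≠ 0 := by positivity
  have e1 : 1 + Real.sqrt 3 ≠ 0 := by positivity
  have e2 : 1 - Real.sqrt 3 ≠ 0 := by linarith
  have e3 : Real.sqrt 3 ≠ 0 := by positivity
  rw [h2, Real.sqrt_mul (by norm_num), show s + Real.sqrt 3 * s = s * (1 + Real.sqrt 3) by ring,
    show s - Real.sqrt 3 * s = s * (1 - Real.sqrt 3) by ring]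
  field_simp
  linear_combination 2 * s ^ 3 * Real.sqrt 3 * h3 + 4 * Real.sqrt 3 * hs3 +
    2 * s ^ 2 * Real.sqrt 3 * (Real.sqrt 3 ^ 2 - 1) * hss

/-- The progression angle `Λ^Θ(C₂)` tends to `√2·π` as `C₂` decreases
to `3·4^(1/3)` from the right. Here `a C₂ > b C₂ > 0 > c C₂` are the three distinct
real roots of `x³ - C₂x + 4` and `r = √C₂`. -/
theorem stmt15 (a b c : ℝ → ℝ)
    (hroots : ∀ C₂ ∈ Set.Ioi (3 * (4 : ℝ) ^ ((1 : ℝ) / 3)),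
      a C₂ > b C₂ ∧ b C₂ > 0 ∧ 0 > c C₂ ∧ Real.sqrt C₂ > a C₂ ∧
      (a C₂) ^ 3 - C₂ * a C₂ + 4 = 0 ∧
      (b C₂) ^ 3 - C₂ * b C₂ + 4 = 0 ∧
      (c C₂) ^ 3 - C₂ * c C₂ + 4 = 0) :
    Tendsto (fun C₂ =>
      4 / ((a C₂ + Real.sqrt C₂) * Real.sqrt (a C₂ - c C₂)) *
        ellipticPi ((a C₂ - b C₂) / (a C₂ + Real.sqrt C₂))
          ((a C₂ - b C₂) / (a C₂ - c C₂)) -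
      4 / ((a C₂ - Real.sqrt C₂) * Real.sqrt (a C₂ - c C₂)) *
        ellipticPi ((a C₂ - b C₂) / (a C₂ - Real.sqrt C₂))
          ((a C₂ - b C₂) / (a C₂ - c C₂)))
      (nhdsWithin (3 * (4 : ℝ) ^ ((1 : ℝ) / 3)) (Set.Ioi (3 * (4 : ℝ) ^ ((1 : ℝ) / 3))))
      (nhds (Real.sqrt 2 * Real.pi)) := by
  obtain ⟨s, hs, hs3, hs2⟩ :
      ∃ s : ℝ, 0 < s ∧ s ^ 3 = 2 ∧ (4 : ℝ) ^ ((1 : ℝ) / 3) = s ^ 2 := by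
    refine ⟨(2 : ℝ) ^ ((1 : ℝ) / 3), by positivity, ?_, ?_⟩
    · rw [← Real.rpow_natCast, ← Real.rpow_mul (by norm_num)]
      norm_num
    · rw [show (4 : ℝ) = 2 ^ (2 : ℝ) by norm_num, ← Real.rpow_natCast,
        ← Real.rpow_mul (by norm_num), ← Real.rpow_mul (by norm_num)]
      norm_num
  rw [hs2] at hroots ⊢
  set l := nhdsWithin (3 * s ^ 2) (Set.Ioi (3 * s ^ 2))
  have hC : Tendsto (fun C : ℝ => C) l (nhds (3 * s ^ 2)) := nhdsWithin_le_nhds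
  have hbd : ∀ᶠ C in l, 2 * s ≤ a C + b C ∧ a C + b C ≤ 2 * Real.sqrt (C / 3) ∧
      a C - b C ≤ 2 * Real.sqrt (C - 3 * s ^ 2) ∧ c C = -(a C + b C) ∧ 0 ≤ a C - b C := by
    filter_upwards [self_mem_nhdsWithin] with C hC
    obtain ⟨h1, h2, h3, -, ha, hb, hc⟩ := hroots C hC
    obtain ⟨k1, k2, k3, k4⟩ := bounds_of_roots hs hs3 h1 h2 h3 ha hb hc
    exact ⟨k1, k2, k3, k4, by linarith⟩
  have hsum : Tendsto (fun C => a C + b C) l (nhds (2 * s)) := by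
    refine tendsto_of_tendsto_of_tendsto_of_le_of_le' tendsto_const_nhds ?_
      (hbd.mono fun _ h => h.1) (hbd.mono fun _ h => h.2.1)
    have h := ((hC.div_const 3).sqrt).const_mul 2
    rwa [mul_div_cancel_left₀ _ three_ne_zero, Real.sqrt_sq hs.le] at h
  have hdiff : Tendsto (fun C => a C - b C) l (nhds 0) := by
    refine tendsto_of_tendsto_of_tendsto_of_le_of_le' tendsto_const_nhds ?_
      (hbd.mono fun _ h => h.2.2.2.2) (hbd.mono fun _ h => h.2.2.1)
    have h := ((hC.sub_const (3 * s ^ 2)).sqrt).const_mul 2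
    rwa [sub_self, Real.sqrt_zero, mul_zero] at h
  have ha : Tendsto a l (nhds s) := by
    have h := (hsum.add hdiff).div_const 2
    rw [show (2 * s + 0) / 2 = s by ring] at h
    exact h.congr fun C => by ring
  have hc : Tendsto c l (nhds (-(2 * s))) :=
    hsum.neg.congr' (hbd.mono fun _ h => h.2.2.2.1.symm)
  have hr : Tendsto (fun C => Real.sqrt C) l (nhds (Real.sqrt 3 * s)) := by
    have h := hC.sqrt
    rwa [Real.sqrt_mul (by norm_num), Real.sqrt_sq hs.le] at h
  have h31 : 1 < Real.sqrt 3 := Real.lt_sqrt_of_sq_lt (by norm_num)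
  have hac : Tendsto (fun C => a C - c C) l (nhds (3 * s)) := by
    have h := ha.sub hc
    rwa [show s - -(2 * s) = 3 * s by ring] at h
  have hplus : s + Real.sqrt 3 * s ≠ 0 := by positivity
  have hminus : s - Real.sqrt 3 * s ≠ 0 := by nlinarith
  have hm : Tendsto (fun C => (a C - b C) / (a C - c C)) l (nhds 0) := by
    simpa only [zero_div, Pi.div_def] using hdiff.div hac (by positivity)
  have hsqrt : Real.sqrt (3 * s) ≠ 0 := by positivity
  have key : ∀ {f : ℝ → ℝ} {y : ℝ}, Tendsto f l (nhds y) → y ≠ 0 →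
      Tendsto (fun C => 4 / (f C * Real.sqrt (a C - c C)) *
        ellipticPi ((a C - b C) / f C) ((a C - b C) / (a C - c C))) l
        (nhds (4 / (y * Real.sqrt (3 * s)) * (Real.pi / 2))) := by
    intro f y hf hy
    have hn : Tendsto (fun C => (a C - b C) / f C) l (nhds 0) := by
      simpa only [zero_div, Pi.div_def] using hdiff.div hf hy
    have hpi := tendsto_ellipticPi_zero.comp (hn.prodMk_nhds hm)
    have hcoef : Tendsto (fun C => 4 / (f C * Real.sqrt (a C - c C))) l
        (nhds (4 / (y * Real.sqrt (3 * s)))) :=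
      Tendsto.div tendsto_const_nhds (hf.mul hac.sqrt) (mul_ne_zero hy hsqrt)
    exact hcoef.mul hpi
  rw [← progression_limit_value hs hs3]
  exact (key (f := fun C => a C + Real.sqrt C) (ha.add hr) hplus).sub
    (key (f := fun C => a C - Real.sqrt C) (ha.sub hr) hminus)
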